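/- Let T be a finite tree on n vertices, let D be its distance matrix, and let S be a subset of the vertices of cardinality m ≥ 2. Then det D[S] = (-1)^{m-1} · 2^{m-2} · ( (n-1)·|F_S(T)| − Σ_{F ∈ F_{S,*}(T)} (bdeg(F_*) − 2)^2 ), where the sum is over all (S,*)-rooted spanning forests F of T and F_* denotes the floating component of F. -/

import Mathlib

open scoped Classical

/-- `H` is an `S`-rooted spanning forest of `G`: an acyclic spanning subgraph in which
distinct vertices of `S` lie in distinct connected components and every vertex is
reachable from some vertex of `S` (so there are exactly `|S|` components, each
containing exactly one vertex of `S`). -/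
def IsSRootedForest {V : Type*} (G H : SimpleGraph V) (S : Finset V) : Prop :=
  H ≤ G ∧ H.IsAcyclic ∧
    (∀ s ∈ S, ∀ t ∈ S, H.Reachable s t → s = t) ∧
    (∀ v : V, ∃ s ∈ S, H.Reachable s v)

/-- The set of vertices not reachable from `S` in `H`; for an `(S,*)`-rooted forest
this is the vertex set of the floating component. -/
def floatSet {V : Type*} (H : SimpleGraph V) (S : Finset V) : Set V :=
  {v | ∀ s ∈ S, ¬ H.Reachable s v}

/-- `H` is an `(S,*)`-rooted spanning forest of `G`: an acyclic spanning subgraph with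
distinct vertices of `S` in distinct components, and whose vertices not reachable from
`S` form a single nonempty connected component (the floating component). -/
def IsSStarRootedForest {V : Type*} (G H : SimpleGraph V) (S : Finset V) : Prop :=
  H ≤ G ∧ H.IsAcyclic ∧
    (∀ s ∈ S, ∀ t ∈ S, H.Reachable s t → s = t) ∧
    (floatSet H S).Nonempty ∧
    (∀ v ∈ floatSet H S, ∀ w ∈ floatSet H S, H.Reachable v w)

/-- The boundary degree of the floating component of `H`: the number of vertices not in
the floating component that are adjacent in `G` to some vertex of the floating
component. -/
noncomputable def bdeg {V : Type*} (G H : SimpleGraph V) (S : Finset V) : ℕ :=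
  Set.ncard {v | v ∉ floatSet H S ∧ ∃ w ∈ floatSet H S, G.Adj v w}


open Finset Matrix

namespace SimpleGraph

variable {V : Type*}

/-- A walk in `F ⊔ edge a b` either can be replaced by a walk in `F` or crosses from one end of
the additional edge to the other. -/
lemma Reachable.of_sup_edge {F : SimpleGraph V} {a b s x : V}
    (h : (F ⊔ edge a b).Reachable s x) :
    F.Reachable s x ∨ (F.Reachable s b ∧ F.Reachable a x) ∨
      (F.Reachable s a ∧ F.Reachable b x) := by
  rw [reachable_iff_reflTransGen] at h
  induction h with
  | refl => exact .inl .rfl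
  | tail _ hyz ih =>
    rw [sup_adj, edge_adj] at hyz
    rcases hyz with hyz | ⟨⟨rfl, rfl⟩ | ⟨rfl, rfl⟩, -⟩
    · rcases ih with ih | ⟨ih, ih'⟩ | ⟨ih, ih'⟩
      · exact .inl (ih.trans hyz.reachable)
      · exact .inr (.inl ⟨ih, ih'.trans hyz.reachable⟩)
      · exact .inr (.inr ⟨ih, ih'.trans hyz.reachable⟩)
    · rcases ih with ih | ⟨ih, ih'⟩ | ⟨ih, ih'⟩
      · exact .inr (.inr ⟨ih, .rfl⟩)
      · exact .inl ih
      · exact .inl (ih.trans ih'.symm)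
    · rcases ih with ih | ⟨ih, ih'⟩ | ⟨ih, ih'⟩
      · exact .inr (.inl ⟨ih, .rfl⟩)
      · exact .inl (ih.trans ih'.symm)
      · exact .inl ih

/-- A path through the dart `(a, b)` reaches `a`, and leaves `b`, without using the edge `ab`. -/
lemma Walk.IsPath.reachable_deleteEdges_of_mem {H : SimpleGraph V} {a b v r : V} {p : H.Walk v r}
    (hp : p.IsPath) (h : (a, b) ∈ p.darts.map Dart.toProd) :
    (H.deleteEdges {s(a, b)}).Reachable v a ∧ (H.deleteEdges {s(a, b)}).Reachable b r := by
  induction p with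
  | nil => simp at h
  | @cons v x r hvx q ih =>
    rw [cons_isPath_iff] at hp
    simp only [darts_cons, List.map_cons, List.mem_cons, Prod.mk.injEq] at h
    rcases h with ⟨rfl, rfl⟩ | h
    · refine ⟨.rfl, ?_⟩
      exact (q.toDeleteEdge _ fun he => hp.2 (q.fst_mem_support_of_mem_edges he)).reachable
    · obtain ⟨h1, h2⟩ := ih hp.1 h
      refine ⟨Reachable.trans ?_ h1, h2⟩
      obtain ⟨d, hd, hdab⟩ := List.mem_map.mp h
      refine Adj.reachable ?_
      rw [deleteEdges_adj]
      refine ⟨hvx, fun he => ?_⟩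
      have ha := q.dart_fst_mem_support_of_mem_darts hd
      have hb := q.dart_snd_mem_support_of_mem_darts hd
      rw [show d.fst = a from congrArg Prod.fst hdab] at ha
      rw [show d.snd = b from congrArg Prod.snd hdab] at hb
      rw [Set.mem_singleton_iff, Sym2.eq_iff] at he
      rcases he with ⟨rfl, rfl⟩ | ⟨rfl, rfl⟩
      · exact hp.2 ha
      · exact hp.2 hb

/-- Flow conservation along a walk. -/
lemma Walk.sum_count_sub_sum_count [Fintype V] {H : SimpleGraph V} {v r : V}
    (p : H.Walk v r) (u : V) :
    ∑ b, ((p.darts.map Dart.toProd).count (u, b) : ℝ) -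
      ∑ b, ((p.darts.map Dart.toProd).count (b, u) : ℝ) =
      (if u = v then 1 else 0) - (if u = r then 1 else 0) := by
  induction p with
  | nil => simp
  | @cons v x r hvx q ih =>
    simp only [darts_cons, List.map_cons, List.count_cons, Nat.cast_add, sum_add_distrib]
    have h1 : ∑ b, (((if (v, x) == (u, b) then 1 else 0 : ℕ)) : ℝ) = if u = v then 1 else 0 := by
      by_cases h : v = u <;> simp [h, eq_comm (a := u)]
    have h2 : ∑ b, (((if (v, x) == (b, u) then 1 else 0 : ℕ)) : ℝ) = if u = x then 1 else 0 := by
      by_cases h : x = u <;> simp [h, eq_comm (a := u)]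
    rw [h1, h2]
    linarith

lemma IsAcyclic.not_reachable_deleteEdges {H : SimpleGraph V} (hH : H.IsAcyclic) {a b : V}
    (hab : H.Adj a b) : ¬ (H.deleteEdges {s(a, b)}).Reachable a b := by
  have := isAcyclic_iff_forall_adj_isBridge.mp hH hab
  rwa [isBridge_iff] at this

lemma deleteEdges_sup_edge {H : SimpleGraph V} {a b : V} (hab : H.Adj a b) :
    H.deleteEdges {s(a, b)} ⊔ edge a b = H := by
  ext x y
  simp only [sup_adj, deleteEdges_adj, edge_adj, Set.mem_singleton_iff, Sym2.eq_iff]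
  constructor
  · rintro (h | ⟨⟨rfl, rfl⟩ | ⟨rfl, rfl⟩, -⟩)
    exacts [h.1, hab, hab.symm]
  · intro h
    have := h.ne
    tauto

lemma sup_edge_deleteEdges {F : SimpleGraph V} {a b : V} (hab : ¬ F.Adj a b) :
    (F ⊔ edge a b).deleteEdges {s(a, b)} = F := by
  ext x y
  simp only [sup_adj, deleteEdges_adj, edge_adj, Set.mem_singleton_iff, Sym2.eq_iff]
  constructor
  · rintro ⟨h | h, h'⟩
    · exact h
    · tauto
  · refine fun h => ⟨.inl h, ?_⟩
    rintro (⟨rfl, rfl⟩ | ⟨rfl, rfl⟩)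
    exacts [hab h, hab h.symm]

end SimpleGraph

open SimpleGraph

section Forests

variable {V : Type*} {G : SimpleGraph V} {S : Finset V}

lemma mem_floatSet_of_reachable {H : SimpleGraph V} {x y : V} (hx : x ∈ floatSet H S)
    (h : H.Reachable x y) : y ∈ floatSet H S :=
  fun s hs hsy => hx s hs (hsy.trans h.symm)

lemma notMem_floatSet {H : SimpleGraph V} {x : V} (hx : x ∈ S) : x ∉ floatSet H S :=
  fun h => h x hx .rfl

/-- Joining the floating component to another component gives a rooted forest. -/
lemma IsSStarRootedForest.sup_edge {F : SimpleGraph V} (hF : IsSStarRootedForest G F S) {a b : V}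
    (hab : G.Adj a b) (ha : a ∈ floatSet F S) (hb : b ∉ floatSet F S) :
    IsSRootedForest G (F ⊔ edge a b) S := by
  obtain ⟨hle, hac, hsep, -, hconn⟩ := hF
  have hnr : ¬ F.Reachable a b := fun h => hb (mem_floatSet_of_reachable ha h)
  refine ⟨sup_le hle ((edge_le_iff _).mpr (.inr hab)), hac.sup_edge_of_not_reachable hnr, ?_, ?_⟩
  · intro s hs t ht hst
    rcases hst.of_sup_edge with h | ⟨-, h⟩ | ⟨h, -⟩
    · exact hsep s hs t ht h
    · exact (ha t ht h.symm).elim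
    · exact (ha s hs h).elim
  · have hF' : F ≤ F ⊔ edge a b := le_sup_left
    intro v
    by_cases hv : v ∈ floatSet F S
    · simp only [floatSet, Set.mem_ofPred_eq, not_forall, not_not] at hb
      obtain ⟨s, hs, hsb⟩ := hb
      have hadj : (F ⊔ edge a b).Adj b a := by simp [edge_adj, hab.ne']
      exact ⟨s, hs, (hsb.mono hF').trans (hadj.reachable.trans ((hconn a ha v hv).mono hF'))⟩
    · simp only [floatSet, Set.mem_ofPred_eq, not_forall, not_not] at hv
      obtain ⟨s, hs, hsv⟩ := hv
      exact ⟨s, hs, hsv.mono hF'⟩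

lemma IsSRootedForest.deleteEdges {H : SimpleGraph V} (hH : IsSRootedForest G H S) {a b : V}
    (hab : H.Adj a b) (ha : a ∈ floatSet (H.deleteEdges {s(a, b)}) S) :
    IsSStarRootedForest G (H.deleteEdges {s(a, b)}) S ∧
      b ∉ floatSet (H.deleteEdges {s(a, b)}) S := by
  obtain ⟨hle, hac, hsep, hcov⟩ := hH
  have hsub : H.deleteEdges {s(a, b)} ≤ H := deleteEdges_le _
  have key : ∀ x ∈ floatSet (H.deleteEdges {s(a, b)}) S,
      (∃ s ∈ S, (H.deleteEdges {s(a, b)}).Reachable s b) ∧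
        (H.deleteEdges {s(a, b)}).Reachable a x := by
    intro x hx
    obtain ⟨s, hs, hsx⟩ := hcov x
    rw [← deleteEdges_sup_edge hab] at hsx
    rcases hsx.of_sup_edge with h | ⟨h, h'⟩ | ⟨h, -⟩
    · exact (hx s hs h).elim
    · exact ⟨⟨s, hs, h⟩, h'⟩
    · exact (ha s hs h).elim
  refine ⟨⟨hsub.trans hle, hac.anti hsub, fun s hs t ht h => hsep s hs t ht (h.mono hsub),
    ⟨a, ha⟩, fun v hv w hw => (key v hv).2.symm.trans (key w hw).2⟩, fun hb => ?_⟩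
  obtain ⟨⟨s, hs, hsb⟩, -⟩ := key a ha
  exact hb s hs hsb

/-- The dart `(a, b)` lies on the path of the forest `H` from `v` to the root of `v`. -/
def OnRootPath (H : SimpleGraph V) (S : Finset V) (v a b : V) : Prop :=
  H.Adj a b ∧ a ∈ floatSet (H.deleteEdges {s(a, b)}) S ∧ v ∈ floatSet (H.deleteEdges {s(a, b)}) S

lemma IsSRootedForest.exists_path {H : SimpleGraph V} (hH : IsSRootedForest G H S) (v : V) :
    ∃ r ∈ S, ∃ p : H.Walk v r, p.IsPath ∧
      ∀ a b, (a, b) ∈ p.darts.map Dart.toProd ↔ OnRootPath H S v a b := by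
  obtain ⟨hle, hac, hsep, hcov⟩ := hH
  obtain ⟨r, hr, hrv⟩ := hcov v
  obtain ⟨p, hp⟩ := hrv.symm.exists_isPath
  refine ⟨r, hr, p, hp, fun a b => ⟨fun h => ?_, fun ⟨hab, ha, hv⟩ => ?_⟩⟩
  · obtain ⟨h1, h2⟩ := hp.reachable_deleteEdges_of_mem h
    obtain ⟨d, hd, hdab⟩ := List.mem_map.mp h
    have hab : H.Adj a b := by
      have := d.adj
      rwa [hdab] at this
    have ha : a ∈ floatSet (H.deleteEdges {s(a, b)}) S := by
      intro s hs hsa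
      have hsr : s = r := hsep s hs r hr
        ((hsa.mono (deleteEdges_le _)).trans (hab.reachable.trans (h2.mono (deleteEdges_le _))))
      subst hsr
      exact hac.not_reachable_deleteEdges hab (hsa.symm.trans h2.symm)
    exact ⟨hab, ha, mem_floatSet_of_reachable ha h1.symm⟩
  · by_cases he : s(a, b) ∈ p.edges
    · rw [Walk.edges, List.mem_map] at he
      obtain ⟨d, hd, hde⟩ := he
      rcases dart_edge_eq_mk'_iff.mp hde with h | h
      · exact List.mem_map.mpr ⟨d, hd, h⟩
      · obtain ⟨-, h2⟩ := hp.reachable_deleteEdges_of_mem (List.mem_map.mpr ⟨d, hd, h⟩)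
        rw [Sym2.eq_swap] at h2
        exact (ha r hr h2.symm).elim
    · exact (hv r hr (p.toDeleteEdge _ he).reachable.symm).elim

lemma isSStarRootedForest_and_mem_iff {F : SimpleGraph V} {u : V} (hu : u ∉ S) :
    IsSStarRootedForest G F S ∧ u ∈ floatSet F S ↔ IsSRootedForest G F (insert u S) := by
  constructor
  · rintro ⟨⟨hle, hac, hsep, -, hconn⟩, huf⟩
    refine ⟨hle, hac, ?_, fun v => ?_⟩
    · simp only [mem_insert]
      rintro s (rfl | hs) t (rfl | ht) h
      exacts [rfl, (huf t ht h.symm).elim, (huf s hs h).elim, hsep s hs t ht h]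
    · by_cases hv : v ∈ floatSet F S
      · exact ⟨u, mem_insert_self .., hconn u huf v hv⟩
      · simp only [floatSet, Set.mem_ofPred_eq, not_forall, not_not] at hv
        obtain ⟨s, hs, hsv⟩ := hv
        exact ⟨s, mem_insert_of_mem hs, hsv⟩
  · rintro ⟨hle, hac, hsep, hcov⟩
    have huf : u ∈ floatSet F S := fun s hs hsu =>
      hu (hsep s (mem_insert_of_mem hs) u (mem_insert_self ..) hsu ▸ hs)
    have key : ∀ v ∈ floatSet F S, F.Reachable u v := by
      intro v hv
      obtain ⟨s, hs, hsv⟩ := hcov v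
      rcases mem_insert.mp hs with rfl | hs
      exacts [hsv, (hv s hs hsv).elim]
    exact ⟨⟨hle, hac, fun s hs t ht => hsep s (mem_insert_of_mem hs) t (mem_insert_of_mem ht),
      ⟨u, huf⟩, fun v hv w hw => (key v hv).symm.trans (key w hw)⟩, huf⟩

end Forests

section Counting

variable {V : Type*} [Fintype V] {G : SimpleGraph V} {S : Finset V}

lemma IsSRootedForest.sum_onRootPath {H : SimpleGraph V} (hH : IsSRootedForest G H S) {u : V}
    (hu : u ∉ S) (v : V) :
    ∑ b, (if OnRootPath H S v u b then 1 else 0 : ℝ) -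
      ∑ b, (if OnRootPath H S v b u then 1 else 0 : ℝ) = if u = v then 1 else 0 := by
  obtain ⟨r, hr, p, hp, hmem⟩ := hH.exists_path v
  have hnd : (p.darts.map Dart.toProd).Nodup :=
    (List.nodup_map_iff Dart.toProd_injective).mpr
      (Walk.darts_nodup_of_support_nodup hp.support_nodup)
  have hc : ∀ a b, (if OnRootPath H S v a b then 1 else 0 : ℝ) =
      ((p.darts.map Dart.toProd).count (a, b) : ℝ) := by
    intro a b
    simp only [hnd.count, hmem]
    split_ifs <;> simp
  simp_rw [hc]
  rw [p.sum_count_sub_sum_count u, if_neg (show u ≠ r from fun h => hu (h ▸ hr)), sub_zero]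

/-- The number of `(S,*)`-rooted spanning forests whose floating component contains
both `u` and `v`. -/
noncomputable def floatCount (G : SimpleGraph V) (S : Finset V) (u v : V) : ℝ :=
  ∑ F : SimpleGraph V with IsSStarRootedForest G F S,
    if u ∈ floatSet F S ∧ v ∈ floatSet F S then 1 else 0

lemma floatCount_of_mem_left {u v : V} (hu : u ∈ S) : floatCount G S u v = 0 := by
  simp [floatCount, notMem_floatSet hu]

lemma sum_float_eq_sum_onRootPath {a b : V} (hab : G.Adj a b) (v : V) :
    ∑ F : SimpleGraph V with IsSStarRootedForest G F S,
      (if a ∈ floatSet F S ∧ v ∈ floatSet F S ∧ b ∉ floatSet F S then 1 else 0 : ℝ) =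
    ∑ H : SimpleGraph V with IsSRootedForest G H S, if OnRootPath H S v a b then 1 else 0 := by
  rw [← sum_filter, ← sum_filter]
  refine sum_bij' (fun F _ => F ⊔ edge a b) (fun H _ => H.deleteEdges {s(a, b)}) ?_ ?_ ?_ ?_ ?_
  · simp only [mem_filter, mem_univ, true_and]
    rintro F ⟨hF, ha, hv, hb⟩
    have hnadj : ¬ F.Adj a b := fun h => hb (mem_floatSet_of_reachable ha h.reachable)
    refine ⟨hF.sup_edge hab ha hb, ?_⟩
    rw [OnRootPath, sup_edge_deleteEdges hnadj]
    exact ⟨by simp [edge_adj, hab.ne], ha, hv⟩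
  · simp only [mem_filter, mem_univ, true_and]
    rintro H ⟨hH, hadj, ha, hv⟩
    have := hH.deleteEdges hadj ha
    exact ⟨this.1, ha, hv, this.2⟩
  · simp only [mem_filter, mem_univ, true_and]
    rintro F ⟨hF, ha, hv, hb⟩
    exact sup_edge_deleteEdges fun h => hb (mem_floatSet_of_reachable ha h.reachable)
  · simp only [mem_filter, mem_univ, true_and]
    rintro H ⟨hH, hadj, ha, hv⟩
    exact deleteEdges_sup_edge hadj
  · simp

lemma floatCount_sub_floatCount {u w : V} (huw : G.Adj u w) (v : V) :
    floatCount G S u v - floatCount G S w v =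
      ∑ H : SimpleGraph V with IsSRootedForest G H S,
        ((if OnRootPath H S v u w then 1 else 0 : ℝ) - if OnRootPath H S v w u then 1 else 0) := by
  rw [sum_sub_distrib, ← sum_float_eq_sum_onRootPath huw, ← sum_float_eq_sum_onRootPath huw.symm,
    floatCount, floatCount, ← sum_sub_distrib, ← sum_sub_distrib]
  refine sum_congr rfl fun F _ => ?_
  by_cases h1 : u ∈ floatSet F S <;> by_cases h2 : w ∈ floatSet F S <;>
    by_cases h3 : v ∈ floatSet F S <;> simp [h1, h2, h3]

/-- The matrix `floatCount` is, up to the number of rooted forests, the Green function of the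
Laplacian with Dirichlet condition on `S`. -/
lemma lapMatrix_mulVec_floatCount {u : V} (hu : u ∉ S) (v : V) :
    (G.lapMatrix ℝ *ᵥ fun w => floatCount G S w v) u =
      #{H : SimpleGraph V | IsSRootedForest G H S} * if u = v then 1 else 0 := by
  rw [lapMatrix_mulVec_apply, ← card_neighborFinset_eq_degree, ← nsmul_eq_mul, ← sum_const,
    ← sum_sub_distrib]
  rw [sum_congr rfl fun w hw => floatCount_sub_floatCount ((mem_neighborFinset ..).mp hw) v,
    sum_comm, ← nsmul_eq_mul, ← sum_const]
  refine sum_congr rfl fun H hH => ?_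
  have hH' := (mem_filter.mp hH).2
  rw [← hH'.sum_onRootPath hu, ← sum_sub_distrib]
  refine sum_subset (subset_univ _) fun w _ hw => ?_
  rw [mem_neighborFinset] at hw
  rw [if_neg fun h => hw (hH'.1 h.1), if_neg fun h => hw (hH'.1 h.1.symm), sub_zero]

lemma floatCount_self {u : V} (hu : u ∉ S) :
    floatCount G S u u = #{H : SimpleGraph V | IsSRootedForest G H (insert u S)} := by
  simp only [floatCount, and_self, ← isSStarRootedForest_and_mem_iff hu, ← filter_filter]
  simp

lemma card_isSRootedForest_univ : #{H : SimpleGraph V | IsSRootedForest G H univ} = 1 := by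
  rw [card_eq_one]
  refine ⟨⊥, ?_⟩
  ext H
  simp only [mem_filter, mem_univ, true_and, mem_singleton]
  constructor
  · rintro ⟨-, -, hsep, -⟩
    ext a b
    simp only [bot_adj, iff_false]
    exact fun h => h.ne (hsep a (mem_univ _) b (mem_univ _) h.reachable)
  · rintro rfl
    exact ⟨bot_le, isAcyclic_bot, fun s _ t _ h => by simpa using h,
      fun v => ⟨v, mem_univ _, .rfl⟩⟩

lemma card_isSRootedForest_singleton (hG : G.IsTree) (r : V) :
    #{H : SimpleGraph V | IsSRootedForest G H {r}} = 1 := by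
  rw [card_eq_one]
  refine ⟨G, ?_⟩
  ext H
  simp only [mem_filter, mem_univ, true_and, mem_singleton]
  constructor
  · rintro ⟨hle, -, -, hcov⟩
    have hr : ∀ v, H.Reachable r v := fun v => by simpa using hcov v
    have hc : H.Connected :=
      { preconnected := fun v w => (hr v).symm.trans (hr w), nonempty := ⟨r⟩ }
    exact le_antisymm hle ((isTree_iff_minimal_connected.mp hG).2 hc hle)
  · rintro rfl
    exact ⟨le_rfl, hG.isAcyclic, by simp, fun v => ⟨r, by simp, hG.connected.preconnected r v⟩⟩

end Counting

section RootedLaplacian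

variable {V : Type*} [Fintype V] {G : SimpleGraph V} {S : Finset V}

/-- The Laplacian matrix of `G` with the rows indexed by `S` replaced by those of the identity. -/
noncomputable def rootedLapMatrix (G : SimpleGraph V) (S : Finset V) : Matrix V V ℝ :=
  of fun i => if i ∈ S then Pi.single i 1 else G.lapMatrix ℝ i

lemma rootedLapMatrix_mulVec_of_mem {i : V} (hi : i ∈ S) (x : V → ℝ) :
    (rootedLapMatrix G S *ᵥ x) i = x i := by
  simp [rootedLapMatrix, mulVec, hi]

lemma rootedLapMatrix_mulVec_of_notMem {i : V} (hi : i ∉ S) (x : V → ℝ) :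
    (rootedLapMatrix G S *ᵥ x) i = (G.lapMatrix ℝ *ᵥ x) i := by
  simp [rootedLapMatrix, mulVec, hi]

lemma rootedLapMatrix_mul_floatCount :
    rootedLapMatrix G S * of (floatCount G S) =
      (#{H : SimpleGraph V | IsSRootedForest G H S} : ℝ) •
        diagonal fun i => if i ∈ S then 0 else 1 := by
  ext i j
  have h : (rootedLapMatrix G S * of (floatCount G S)) i j =
    (rootedLapMatrix G S *ᵥ fun w => floatCount G S w j) i := rfl
  rw [h]
  by_cases hi : i ∈ S
  · rw [rootedLapMatrix_mulVec_of_mem hi, floatCount_of_mem_left hi]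
    simp [diagonal_apply, hi]
  · rw [rootedLapMatrix_mulVec_of_notMem hi, lapMatrix_mulVec_floatCount hi]
    simp [diagonal_apply, hi]

lemma det_rootedLapMatrix_smul_floatCount :
    (rootedLapMatrix G S).det • of (floatCount G S) =
      (#{H : SimpleGraph V | IsSRootedForest G H S} : ℝ) •
        ((rootedLapMatrix G S).adjugate * diagonal fun i => if i ∈ S then 0 else 1) := by
  rw [← mul_smul_comm, ← rootedLapMatrix_mul_floatCount, ← Matrix.mul_assoc, adjugate_mul,
    smul_mul_assoc, Matrix.one_mul]

lemma adjugate_rootedLapMatrix_self (u : V) :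
    (rootedLapMatrix G S).adjugate u u = (rootedLapMatrix G (insert u S)).det := by
  rw [adjugate_apply]
  congr 1
  ext i j
  by_cases h : i = u
  · subst h
    simp [rootedLapMatrix]
  · simp [rootedLapMatrix, updateRow_apply, h]

lemma det_rootedLapMatrix_ne_zero (hG : G.Connected) (hS : S.Nonempty) :
    (rootedLapMatrix G S).det ≠ 0 := by
  intro hdet
  obtain ⟨x, hx0, hx⟩ := exists_mulVec_eq_zero_iff.mpr hdet
  have hS0 : ∀ s ∈ S, x s = 0 := fun s hs => by
    rw [← rootedLapMatrix_mulVec_of_mem (G := G) hs x, hx, Pi.zero_apply]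
  have hxL : toLinearMap₂' ℝ (G.lapMatrix ℝ) x x = 0 := by
    rw [toLinearMap₂'_apply']
    refine sum_eq_zero fun i _ => ?_
    by_cases hi : i ∈ S
    · rw [hS0 i hi, zero_mul]
    · rw [← rootedLapMatrix_mulVec_of_notMem hi, hx, Pi.zero_apply, mul_zero]
  rw [lapMatrix_toLinearMap₂'_apply'_eq_zero_iff_forall_reachable] at hxL
  obtain ⟨s, hs⟩ := hS
  exact hx0 (funext fun v => (hxL v s (hG.preconnected v s)).trans (hS0 s hs))

/-- The matrix-tree theorem for rooted forests of a connected graph. -/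
theorem det_rootedLapMatrix (hG : G.Connected) (hS : S.Nonempty) :
    (rootedLapMatrix G S).det = #{H : SimpleGraph V | IsSRootedForest G H S} := by
  induction hk : #Sᶜ generalizing S with
  | zero =>
    rw [card_eq_zero, compl_eq_empty_iff] at hk
    subst hk
    rw [card_isSRootedForest_univ, Nat.cast_one, ← det_one (n := V)]
    congr 1
    ext i j
    simp [rootedLapMatrix, one_apply, Pi.single_apply, eq_comm]
  | succ k ih =>
    obtain ⟨u, hu⟩ : Sᶜ.Nonempty := card_pos.mp (by omega)
    have hu' := mem_compl.mp hu
    have hins : #(insert u S)ᶜ = k := by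
      rw [compl_insert, card_erase_of_mem hu, hk, Nat.add_sub_cancel]
    have hdet := ih (insert_nonempty u S) hins
    have hne := det_rootedLapMatrix_ne_zero hG (insert_nonempty u S)
    have h := congrFun (congrFun (det_rootedLapMatrix_smul_floatCount (G := G) (S := S)) u) u
    simp only [Matrix.smul_apply, of_apply, mul_diagonal, hu', if_false, mul_one, smul_eq_mul,
      floatCount_self hu', adjugate_rootedLapMatrix_self, ← hdet] at h
    exact mul_right_cancel₀ hne h

lemma adjugate_rootedLapMatrix_mul_diagonal (hG : G.Connected) (hS : S.Nonempty) :
    (rootedLapMatrix G S).adjugate * (diagonal fun i => if i ∈ S then 0 else 1) =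
      of (floatCount G S) := by
  have h := det_rootedLapMatrix_smul_floatCount (G := G) (S := S)
  rw [← det_rootedLapMatrix hG hS] at h
  exact (smul_right_injective _ (det_rootedLapMatrix_ne_zero hG hS) h).symm

end RootedLaplacian

section TreeDistance

/-- In a tree, a vertex outside a connected set is adjacent to at most one vertex of the set. -/
lemma SimpleGraph.IsTree.eq_of_adj_of_adj {V : Type*} {G : SimpleGraph V}
    (hG : G.IsTree) {C : Set V} (hC : (G.induce C).Preconnected) {w u₁ u₂ : V}
    (hw : w ∉ C) (h₁ : u₁ ∈ C) (h₂ : u₂ ∈ C)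
    (hw₁ : G.Adj w u₁) (hw₂ : G.Adj w u₂) : u₁ = u₂ := by
  by_contra hne
  refine hG.isAcyclic.not_reachable_deleteEdges hw₁ ?_
  have hadj : (G.deleteEdges {s(w, u₁)}).Adj w u₂ := by
    rw [deleteEdges_adj]
    refine ⟨hw₂, fun h => ?_⟩
    rw [Set.mem_singleton_iff, Sym2.eq_iff] at h
    rcases h with ⟨-, h⟩ | ⟨h, -⟩
    exacts [hne h.symm, hw (h ▸ h₁)]
  let f : G.induce C →g G.deleteEdges {s(w, u₁)} :=
    { toFun := Subtype.val
      map_rel' := by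
        rintro ⟨x, hx⟩ ⟨y, hy⟩ hxy
        rw [deleteEdges_adj]
        refine ⟨hxy, fun h => ?_⟩
        rw [Set.mem_singleton_iff, Sym2.eq_iff] at h
        rcases h with ⟨rfl, -⟩ | ⟨-, rfl⟩
        exacts [hw hx, hw hy] }
  exact hadj.reachable.trans ((hC ⟨u₂, h₂⟩ ⟨u₁, h₁⟩).map f)

variable {V : Type*} [Fintype V] {G : SimpleGraph V}

/-- On a tree, the Laplacian of the distance to a fixed vertex. -/
lemma SimpleGraph.IsTree.lapMatrix_mulVec_dist (hG : G.IsTree) (i j : V) :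
    (G.lapMatrix ℝ *ᵥ fun k => (G.dist k j : ℝ)) i =
      (2 - G.degree i) - 2 * if i = j then 1 else 0 := by
  rw [lapMatrix_mulVec_apply]
  by_cases hij : i = j
  · subst hij
    have h : ∀ w ∈ G.neighborFinset i, (G.dist w i : ℝ) = 1 := fun w hw => by
      rw [mem_neighborFinset] at hw
      rw [dist_eq_one_iff_adj.mpr hw.symm, Nat.cast_one]
    rw [sum_congr rfl h]
    simp
  · obtain ⟨p, hp, hlen⟩ := hG.connected.exists_path_of_dist i j
    have hnil : ¬ p.Nil := Walk.not_nil_of_ne hij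
    have hsnd : p.snd ∈ G.neighborFinset i := by
      rw [mem_neighborFinset]
      exact p.adj_snd hnil
    have h : ∀ w ∈ G.neighborFinset i,
        (G.dist w j : ℝ) = (G.dist i j + 1) - 2 * if w = p.snd then 1 else 0 := by
      intro w hw
      rw [mem_neighborFinset] at hw
      have hd := hG.dist_eq_dist_add_one_of_adj j hw
      rw [dist_comm (u := j), dist_comm (u := j)] at hd
      by_cases hws : w = p.snd
      · have h1 := Walk.length_tail_add_one hnil
        have h2 : G.dist w j ≤ p.tail.length := by
          rw [hws]
          exact dist_le p.tail
        have h3 : G.dist i j = G.dist w j + 1 := by omega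
        rw [if_pos hws, h3]
        push_cast
        ring
      · have h3 : G.dist w j = G.dist i j + 1 := by
          refine hd.resolve_left fun h => hws ?_
          obtain ⟨q, -, hq⟩ := hG.connected.exists_path_of_dist w j
          have hqp : (Walk.cons hw q).IsPath :=
            Walk.isPath_of_length_eq_dist _ (by rw [Walk.length_cons, hq, h])
          have hpq : Walk.cons hw q = p := congrArg Subtype.val
            ((hG.isAcyclic.subsingleton_path i j).elim ⟨_, hqp⟩ ⟨p, hp⟩)
          rw [← hpq, Walk.snd_cons]
        rw [if_neg hws, h3]
        push_cast
        ring
    rw [sum_congr rfl h, sum_sub_distrib, ← mul_sum, sum_ite_eq', if_pos hsnd, if_neg hij,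
      sum_const, card_neighborFinset_eq_degree, nsmul_eq_mul]
    ring

lemma SimpleGraph.IsTree.sum_degree (hG : G.IsTree) :
    ∑ i, (G.degree i : ℝ) = 2 * (Fintype.card V - 1) := by
  rw [← Nat.cast_sum, sum_degrees_eq_twice_card_edges, ← hG.card_edgeFinset]
  push_cast
  ring

lemma SimpleGraph.IsTree.sum_dist_mul (hG : G.IsTree) (j : V) :
    ∑ i, (2 - G.degree i : ℝ) * G.dist i j = Fintype.card V - 1 := by
  have h1 : toLinearMap₂' ℝ (G.lapMatrix ℝ) (fun k => (G.dist k j : ℝ)) (fun k => (G.dist k j : ℝ))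
      = Fintype.card V - 1 := by
    rw [lapMatrix_toLinearMap₂']
    have h : ∀ i k, (if G.Adj i k then ((G.dist i j : ℝ) - G.dist k j) ^ 2 else 0) =
        if G.Adj i k then 1 else 0 := by
      intro i k
      split_ifs with hik
      · have hd := hG.dist_eq_dist_add_one_of_adj j hik
        rw [dist_comm (u := j), dist_comm (u := j)] at hd
        rcases hd with hd | hd <;> rw [hd] <;> push_cast <;> ring
      · rfl
    simp_rw [h, ← degree_eq_sum_if_adj]
    rw [hG.sum_degree]
    ring
  rw [toLinearMap₂'_apply'] at h1
  rw [← h1]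
  refine sum_congr rfl fun i _ => ?_
  rw [hG.lapMatrix_mulVec_dist]
  by_cases hij : i = j <;> simp [hij]
  ring

lemma SimpleGraph.IsTree.sum_two_sub_degree (hG : G.IsTree) {C : Set V}
    (hC : (G.induce C).Connected) :
    ∑ u with u ∈ C, (2 - G.degree u : ℝ) = 2 - Set.ncard {v | v ∉ C ∧ ∃ w ∈ C, G.Adj v w} := by
  have hT : (G.induce C).IsTree := ⟨hC, hG.isAcyclic.induce C⟩
  have hin : ∑ u with u ∈ C, ∑ w with w ∈ C, (if G.Adj u w then 1 else 0 : ℝ) =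
      2 * (#{u | u ∈ C} - 1) := by
    have h := hT.sum_degree
    simp_rw [degree_eq_sum_if_adj] at h
    rw [Fintype.card_subtype] at h
    rw [← h, sum_subtype (p := (· ∈ C)) _ (by simp)]
    refine sum_congr rfl fun u _ => ?_
    rw [sum_subtype (p := (· ∈ C)) _ (by simp)]
    rfl
  have hout : ∑ u with u ∈ C, ∑ w with w ∉ C, (if G.Adj u w then 1 else 0 : ℝ) =
      Set.ncard {v | v ∉ C ∧ ∃ w ∈ C, G.Adj v w} := by
    rw [sum_comm, Set.ncard_eq_toFinset_card', Set.toFinset_ofPred, ← filter_filter,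
      card_filter, Nat.cast_sum]
    refine sum_congr rfl fun w hw => ?_
    have hwC := (mem_filter.mp hw).2
    by_cases h : ∃ u ∈ C, G.Adj w u
    · rw [if_pos h]
      obtain ⟨u, hu, hwu⟩ := h
      rw [sum_eq_single u]
      · simp [hwu.symm]
      · intro x hx hxu
        rw [if_neg]
        exact fun hxw => hxu (hG.eq_of_adj_of_adj hC.preconnected hwC (mem_filter.mp hx).2 hu
          hxw.symm hwu)
      · exact fun h => (h (mem_filter.mpr ⟨mem_univ _, hu⟩)).elim
    · rw [if_neg h, Nat.cast_zero]
      refine sum_eq_zero fun u hu => if_neg fun huw => h ⟨u, (mem_filter.mp hu).2, huw.symm⟩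
  simp_rw [sum_sub_distrib, degree_eq_sum_if_adj,
    ← sum_filter_add_sum_filter_not univ (· ∈ C) (fun w => (if G.Adj _ w then 1 else 0 : ℝ))]
  rw [sum_add_distrib, hin, hout, sum_const, nsmul_eq_mul]
  ring

variable {S : Finset V}

lemma IsSStarRootedForest.sum_two_sub_degree (hG : G.IsTree) {F : SimpleGraph V}
    (hF : IsSStarRootedForest G F S) :
    ∑ u with u ∈ floatSet F S, (2 - G.degree u : ℝ) = 2 - bdeg G F S := by
  refine hG.sum_two_sub_degree ?_
  obtain ⟨hle, -, -, hne, hconn⟩ := hF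
  have key : ∀ {v w : V} (hv : v ∈ floatSet F S) (hw : w ∈ floatSet F S), F.Walk v w →
      (G.induce (floatSet F S)).Reachable ⟨v, hv⟩ ⟨w, hw⟩ := by
    intro v w hv hw p
    induction p with
    | nil => exact .rfl
    | cons h q ih =>
      have hx := mem_floatSet_of_reachable hv h.reachable
      exact Reachable.trans (show (G.induce _).Adj ⟨_, hv⟩ ⟨_, hx⟩ from hle h).reachable (ih hx hw)
  have := hne.to_subtype
  exact ⟨fun v w => (hconn v v.2 w w.2).elim (key v.2 w.2)⟩

lemma dotProduct_floatCount_mulVec (hG : G.IsTree) :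
    (fun i => 2 - G.degree i : V → ℝ) ⬝ᵥ (of (floatCount G S) *ᵥ fun i => 2 - G.degree i) =
      ∑ F : SimpleGraph V with IsSStarRootedForest G F S, ((bdeg G F S : ℝ) - 2) ^ 2 := by
  have h : ∀ F ∈ ({F | IsSStarRootedForest G F S} : Finset (SimpleGraph V)),
      ((bdeg G F S : ℝ) - 2) ^ 2 = ∑ u, ∑ v, (2 - G.degree u : ℝ) *
        ((if u ∈ floatSet F S ∧ v ∈ floatSet F S then 1 else 0) * (2 - G.degree v : ℝ)) := by
    intro F hF
    rw [← neg_sq, neg_sub, ← (mem_filter.mp hF).2.sum_two_sub_degree hG, sq, sum_filter,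
      sum_mul_sum]
    refine sum_congr rfl fun u _ => sum_congr rfl fun v _ => ?_
    by_cases hu : u ∈ floatSet F S <;> by_cases hv : v ∈ floatSet F S <;> simp [hu, hv]
  rw [sum_congr rfl h, sum_comm]
  refine sum_congr rfl fun u _ => ?_
  rw [sum_comm, mulVec, dotProduct, mul_sum]
  refine sum_congr rfl fun v _ => ?_
  rw [← mul_sum, ← sum_mul]
  rfl

end TreeDistance

section DistanceMatrix

variable {V : Type*} [Fintype V] {G : SimpleGraph V} {S : Finset V}

lemma Matrix.det_add_vecMulVec_of_isUnit {A : Matrix V V ℝ} (hA : IsUnit A.det) (u v : V → ℝ) :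
    (A + vecMulVec u v).det = A.det + v ⬝ᵥ (A.adjugate *ᵥ u) := by
  have h : vecMulVec u v = replicateCol Unit u * replicateRow Unit v := by
    ext i j
    simp [vecMulVec_apply, mul_apply]
  have h1 : (1 + replicateRow Unit v * A⁻¹ * replicateCol Unit u).det =
      1 + v ⬝ᵥ (A⁻¹ *ᵥ u) := by
    rw [Matrix.mul_assoc, ← replicateCol_mulVec, det_unique, Matrix.add_apply,
      replicateRow_mul_replicateCol_apply, one_apply_eq]
  rw [h, det_add_replicateCol_mul_replicateRow hA, h1, mul_add, mul_one, inv_def, smul_mulVec,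
    dotProduct_smul, smul_eq_mul, Ring.inverse_eq_inv', mul_inv_cancel_left₀ hA.ne_zero]

lemma Matrix.det_eq_det_of_forall_notMem {M : Matrix V V ℝ}
    (hM : ∀ i ∉ S, ∀ j, M i j = (1 : Matrix V V ℝ) i j) :
    M.det = (of fun i j : {x // x ∈ S} => M i j).det := by
  rw [twoBlockTriangular_det M (· ∈ S) fun i hi j hj => by
    rw [hM i hi, one_apply_ne]; rintro rfl; exact hi hj]
  have h1 : (toSquareBlockProp M fun i => ¬ i ∈ S) = 1 := by
    ext i j
    rw [toSquareBlockProp_def, of_apply, hM i i.2]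
    simp [one_apply, Subtype.ext_iff]
  rw [h1, det_one, mul_one]
  congr!

/-- The distance matrix of a graph, with real entries. -/
noncomputable def distMatrix (G : SimpleGraph V) : Matrix V V ℝ :=
  of fun i j => (G.dist i j : ℝ)

/-- The Graham–Lovász inverse of the distance matrix of a tree. -/
noncomputable def invDistMatrix (G : SimpleGraph V) : Matrix V V ℝ :=
  (-1 / 2 : ℝ) • (G.lapMatrix ℝ +
    vecMulVec (fun i => -(2 - G.degree i : ℝ) / (Fintype.card V - 1)) fun i => 2 - G.degree i)

lemma invDistMatrix_mul_distMatrix (hG : G.IsTree) (hV : 2 ≤ Fintype.card V) :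
    invDistMatrix G * distMatrix G = 1 := by
  have hc : (Fintype.card V - 1 : ℝ) ≠ 0 := by
    have : (2 : ℝ) ≤ Fintype.card V := by exact_mod_cast hV
    linarith
  ext i j
  have h1 : (G.lapMatrix ℝ * distMatrix G) i j =
      (G.lapMatrix ℝ *ᵥ fun k => (G.dist k j : ℝ)) i := rfl
  have h2 : ((fun i => 2 - G.degree i : V → ℝ) ᵥ* distMatrix G) j = Fintype.card V - 1 :=
    hG.sum_dist_mul j
  rw [invDistMatrix, smul_mul_assoc, Matrix.add_mul, vecMulVec_mul, Matrix.smul_apply,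
    Matrix.add_apply, h1, hG.lapMatrix_mulVec_dist, vecMulVec_apply, h2, one_apply]
  rw [div_mul_cancel₀ _ hc, smul_eq_mul]
  ring

lemma adjugate_invDistMatrix (hG : G.IsTree) (hV : 2 ≤ Fintype.card V) :
    (invDistMatrix G).adjugate = (invDistMatrix G).det • distMatrix G := by
  calc (invDistMatrix G).adjugate
      = (invDistMatrix G).adjugate * (invDistMatrix G * distMatrix G) := by
        rw [invDistMatrix_mul_distMatrix hG hV, Matrix.mul_one]
    _ = _ := by rw [← Matrix.mul_assoc, adjugate_mul, smul_mul_assoc, Matrix.one_mul]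

lemma sum_lapMatrix_apply (j : V) : ∑ i, G.lapMatrix ℝ i j = 0 := by
  have h := congrFun (G.lapMatrix_mulVec_const_eq_zero (R := ℝ)) j
  simp only [mulVec, dotProduct, mul_one, Pi.zero_apply] at h
  rw [← h]
  exact sum_congr rfl fun i _ => (G.isSymm_lapMatrix ℝ).apply j i

lemma det_lapMatrix_add_single (hG : G.IsTree) (r : V) :
    (G.lapMatrix ℝ + vecMulVec (Pi.single r 1) (Pi.single r 1)).det = 1 := by
  have h : (G.lapMatrix ℝ + vecMulVec (Pi.single r 1) (Pi.single r 1)).updateRow r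
      (∑ k, (1 : V → ℝ) k •
        (G.lapMatrix ℝ + vecMulVec (Pi.single r 1) (Pi.single r 1) : Matrix V V ℝ) k) =
      rootedLapMatrix G {r} := by
    ext i j
    by_cases hi : i = r
    · subst hi
      rw [updateRow_self, Finset.sum_apply]
      simp [rootedLapMatrix, sum_add_distrib, sum_lapMatrix_apply, vecMulVec_apply, ← sum_mul]
    · simp [rootedLapMatrix, updateRow_apply, hi, vecMulVec_apply]
  have h2 := det_updateRow_sum (G.lapMatrix ℝ + vecMulVec (Pi.single r 1) (Pi.single r 1)) r 1
  rw [h, det_rootedLapMatrix hG.connected (singleton_nonempty r),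
    card_isSRootedForest_singleton hG] at h2
  simpa using h2.symm

lemma det_invDistMatrix (hG : G.IsTree) (hV : 2 ≤ Fintype.card V) :
    (invDistMatrix G).det = (-1 / 2) ^ Fintype.card V * (-4 / (Fintype.card V - 1)) := by
  have hc : (Fintype.card V - 1 : ℝ) ≠ 0 := by
    have : (2 : ℝ) ≤ Fintype.card V := by exact_mod_cast hV
    linarith
  obtain ⟨r⟩ := hG.connected.nonempty
  have hunit : IsUnit (invDistMatrix G).det :=
    isUnit_det_of_right_inverse (invDistMatrix_mul_distMatrix hG hV)
  have h1 := det_add_vecMulVec_of_isUnit hunit ((-1 / 2 : ℝ) • Pi.single r 1) (Pi.single r 1)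
  rw [adjugate_invDistMatrix hG hV] at h1
  have h2 : invDistMatrix G + vecMulVec ((-1 / 2 : ℝ) • Pi.single r 1) (Pi.single r 1) =
      (-1 / 2 : ℝ) • (G.lapMatrix ℝ + vecMulVec (Pi.single r 1) (Pi.single r 1) +
        vecMulVec (fun i => -(2 - G.degree i : ℝ) / (Fintype.card V - 1))
          fun i => 2 - G.degree i) := by
    rw [invDistMatrix, smul_vecMulVec, ← smul_add]
    congr 1
    abel
  have hA := det_lapMatrix_add_single hG r
  set A := G.lapMatrix ℝ + vecMulVec (Pi.single r 1) (Pi.single r 1) with hAdef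
  have h3 : A *ᵥ (fun i => (G.dist i r : ℝ) + 2) = fun i => (2 - G.degree i : ℝ) := by
    have : (fun i => (G.dist i r : ℝ) + 2) = (fun i => (G.dist i r : ℝ)) + (2 : ℝ) • fun _ => 1 := by
      ext i
      simp
    ext i
    rw [hAdef, add_mulVec, this, mulVec_add (G.lapMatrix ℝ), mulVec_smul,
      lapMatrix_mulVec_const_eq_zero, smul_zero, add_zero, Pi.add_apply, hG.lapMatrix_mulVec_dist,
      vecMulVec_mulVec]
    simp [Pi.single_apply]
  have h4 : A.adjugate *ᵥ (fun i => (2 - G.degree i : ℝ)) = fun i => (G.dist i r : ℝ) + 2 := by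
    rw [← h3, mulVec_mulVec, adjugate_mul, hA, one_smul, one_mulVec]
  have h5 : (fun i => -(2 - G.degree i : ℝ) / (Fintype.card V - 1)) =
      (-1 / (Fintype.card V - 1 : ℝ)) • fun i => (2 - G.degree i : ℝ) := by
    ext i
    simp only [Pi.smul_apply, smul_eq_mul]
    ring
  have h6 : (fun i => (2 - G.degree i : ℝ)) ⬝ᵥ (fun i => (G.dist i r : ℝ) + 2) =
      Fintype.card V - 1 + 4 := by
    simp only [dotProduct, mul_add, sum_add_distrib, hG.sum_dist_mul, ← sum_mul, sum_sub_distrib,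
      hG.sum_degree, sum_const, card_univ, nsmul_eq_mul]
    ring
  rw [h2, det_smul, det_add_vecMulVec_of_isUnit (by rw [hA]; exact isUnit_one), hA, h5,
    mulVec_smul, h4, dotProduct_smul, h6] at h1
  have h7 : (Pi.single r 1 : V → ℝ) ⬝ᵥ (((invDistMatrix G).det • distMatrix G) *ᵥ
      ((-1 / 2 : ℝ) • Pi.single r 1)) = 0 := by
    simp [distMatrix, mulVec_smul]
  rw [h7, add_zero] at h1
  rw [← h1, smul_eq_mul]
  congr 1
  field_simp
  ring

/-- The determinant of the inverse distance matrix with the rows indexed by `S` replaced by those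
of the identity. -/
lemma det_of_ite_invDistMatrix (hG : G.IsTree) (hS : S.Nonempty) :
    (of fun i => if i ∈ S then Pi.single i 1 else invDistMatrix G i : Matrix V V ℝ).det =
      (-1 / 2) ^ #Sᶜ * ((#{H : SimpleGraph V | IsSRootedForest G H S} : ℝ) -
        (∑ F : SimpleGraph V with IsSStarRootedForest G F S, ((bdeg G F S : ℝ) - 2) ^ 2) /
          (Fintype.card V - 1)) := by
  have h1 : (of fun i => if i ∈ S then Pi.single i 1 else invDistMatrix G i : Matrix V V ℝ) =
      diagonal (fun i => if i ∈ S then 1 else (-1 / 2 : ℝ)) * (rootedLapMatrix G S +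
        vecMulVec ((-1 / (Fintype.card V - 1) : ℝ) • (diagonal (fun i => if i ∈ S then 0 else 1) *ᵥ
          fun i => (2 - G.degree i : ℝ))) fun i => 2 - G.degree i) := by
    ext i j
    rw [diagonal_mul, Matrix.add_apply, vecMulVec_apply, Pi.smul_apply, mulVec_diagonal]
    by_cases hi : i ∈ S
    · simp [rootedLapMatrix, hi]
    · simp only [of_apply, hi, if_false, invDistMatrix, rootedLapMatrix, Matrix.smul_apply,
        Matrix.add_apply, vecMulVec_apply, smul_eq_mul]
      ring
  rw [h1, det_mul, det_diagonal, det_add_vecMulVec_of_isUnit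
    (det_rootedLapMatrix_ne_zero hG.connected hS).isUnit, mulVec_smul, mulVec_mulVec,
    adjugate_rootedLapMatrix_mul_diagonal hG.connected hS, dotProduct_smul,
    dotProduct_floatCount_mulVec hG, det_rootedLapMatrix hG.connected hS, prod_ite, prod_const_one,
    one_mul, prod_const, filter_not, filter_mem_eq_inter, univ_inter, ← compl_eq_univ_sdiff,
    smul_eq_mul]
  ring

lemma det_of_ite_invDistMatrix_mul (hG : G.IsTree) (hV : 2 ≤ Fintype.card V) :
    (of fun i => if i ∈ S then Pi.single i 1 else invDistMatrix G i : Matrix V V ℝ).det *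
      (distMatrix G).det = (of fun i j : {x // x ∈ S} => (G.dist i.val j.val : ℝ)).det := by
  rw [← det_mul, det_eq_det_of_forall_notMem (S := S) fun i hi j => by
    rw [← invDistMatrix_mul_distMatrix hG hV]
    simp [mul_apply, hi]]
  congr 1
  ext i j
  simp [mul_apply, distMatrix, Pi.single_apply]

end DistanceMatrix

theorem distance_matrix_principal_minor_richman
    {V : Type*} [Fintype V] (G : SimpleGraph V) (hG : G.IsTree)
    (n : ℕ) (hn : Fintype.card V = n)
    (S : Finset V) (m : ℕ) (hm : S.card = m) (hm2 : 2 ≤ m) :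
    Matrix.det (Matrix.of fun i j : {x // x ∈ S} => (G.dist i.val j.val : ℤ)) =
      (-1) ^ (m - 1) * 2 ^ (m - 2) *
        (((n : ℤ) - 1) *
            (Finset.univ.filter (fun H : SimpleGraph V => IsSRootedForest G H S)).card -
          ∑ H ∈ Finset.univ.filter (fun H : SimpleGraph V => IsSStarRootedForest G H S),
            ((bdeg G H S : ℤ) - 2) ^ 2) := by
  subst hn hm
  obtain ⟨k, hk⟩ := Nat.exists_eq_add_of_le hm2
  have hV : 2 ≤ Fintype.card V := hm2.trans (card_le_univ S)
  have hS : S.Nonempty := card_pos.mp (by omega)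
  have hc : (Fintype.card V - 1 : ℝ) ≠ 0 := by
    have : (2 : ℝ) ≤ Fintype.card V := by exact_mod_cast hV
    linarith
  have hdet : (invDistMatrix G).det * (distMatrix G).det = 1 := by
    rw [← det_mul, invDistMatrix_mul_distMatrix hG hV, det_one]
  have hmain := det_of_ite_invDistMatrix_mul (S := S) hG hV
  rw [det_of_ite_invDistMatrix hG hS] at hmain
  rw [det_invDistMatrix hG hV] at hdet
  have hcard : Fintype.card V = #Sᶜ + (2 + k) := by
    rw [← hk, add_comm, card_add_card_compl]
  have hcast : (((of fun i j : {x // x ∈ S} => (G.dist i.val j.val : ℤ)).det : ℤ) : ℝ) =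
      (of fun i j : {x // x ∈ S} => (G.dist i.val j.val : ℝ)).det := by
    rw [Int.cast_det]
    congr 1
  rw [← Int.cast_inj (α := ℝ), hcast, ← hmain, hk]
  have hk1 : 2 + k - 1 = k + 1 := by omega
  have hk2 : 2 + k - 2 = k := by omega
  rw [hk1, hk2]
  push_cast
  set c : ℝ := Fintype.card V - 1
  rw [hcard, pow_add] at hdet
  set x : ℝ := (-1 / 2) ^ #Sᶜ
  set D := (distMatrix G).det
  have hx : x * D = -(-2) ^ (2 + k) * c / 4 := by
    have h2 : ((-1 / 2 : ℝ)) ^ (2 + k) * (-2) ^ (2 + k) = 1 := by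
      rw [← mul_pow]
      norm_num
    field_simp at hdet
    linear_combination (-(-2 : ℝ) ^ (2 + k) / 4) * hdet - x * D * h2
  have h2 : (-2 : ℝ) ^ (2 + k) = -4 * ((-1) ^ (k + 1) * 2 ^ k) := by
    rw [show (-2 : ℝ) = -1 * 2 by norm_num, mul_pow]
    ring
  rw [h2] at hx
  rw [mul_right_comm, hx]
  field_simp
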